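/- Let 1 ≤ n ≤ N. Then κ(n,N) ≥ exp( (n−1) / (2·⌈N/n⌉) ) ≥ 1 + n(n−1)/(2(N+n)). -/

import Mathlib

open scoped BigOperators TensorProduct
open PiTensorProduct

noncomputable section

/-- The projective tensor norm `‖·‖_π` on the `n`-th algebraic tensor power `E^⊗n`. -/
def projNorm {E : Type*} [NormedAddCommGroup E] [NormedSpace ℝ E] (n : ℕ)
    (t : ⨂[ℝ] (_ : Fin n), E) : ℝ :=
  sInf {s : ℝ | ∃ (N : ℕ) (a : Fin N → ℝ) (x : Fin N → Fin n → E),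
    t = ∑ k, a k • (⨂ₜ[ℝ] i, x k i) ∧ s = ∑ k, |a k| * ∏ i, ‖x k i‖}

/-- The positive projective tensor norm `‖·‖_{π+}` on `E^⊗n`: only decompositions into
elementary tensors of elements of the positive cone `P` are allowed. -/
def projNormPos {E : Type*} [NormedAddCommGroup E] [NormedSpace ℝ E] (P : Set E) (n : ℕ)
    (t : ⨂[ℝ] (_ : Fin n), E) : ℝ :=
  sInf {s : ℝ | ∃ (N : ℕ) (a : Fin N → ℝ) (x : Fin N → Fin n → E),
    (∀ k i, x k i ∈ P) ∧ t = ∑ k, a k • (⨂ₜ[ℝ] i, x k i) ∧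
    s = ∑ k, |a k| * ∏ i, ‖x k i‖}

/-- The symmetric projective tensor norm `‖·‖_{πs}` (decompositions into tensor powers). -/
def symProjNorm {E : Type*} [NormedAddCommGroup E] [NormedSpace ℝ E] (n : ℕ)
    (t : ⨂[ℝ] (_ : Fin n), E) : ℝ :=
  sInf {s : ℝ | ∃ (N : ℕ) (a : Fin N → ℝ) (x : Fin N → E),
    t = ∑ k, a k • (⨂ₜ[ℝ] (_ : Fin n), x k) ∧ s = ∑ k, |a k| * ‖x k‖ ^ n}

/-- The positive symmetric projective tensor norm `‖·‖_{πs+}` (decompositions into tensor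
powers of elements of the positive cone `P`). -/
def symProjNormPos {E : Type*} [NormedAddCommGroup E] [NormedSpace ℝ E] (P : Set E) (n : ℕ)
    (t : ⨂[ℝ] (_ : Fin n), E) : ℝ :=
  sInf {s : ℝ | ∃ (N : ℕ) (a : Fin N → ℝ) (x : Fin N → E),
    (∀ k, x k ∈ P) ∧ t = ∑ k, a k • (⨂ₜ[ℝ] (_ : Fin n), x k) ∧
    s = ∑ k, |a k| * ‖x k‖ ^ n}

/-- `‖x‖₊ = inf{‖y‖+‖z‖ : x = y − z, y,z ∈ P}`. -/
def normPlus {E : Type*} [NormedAddCommGroup E] (P : Set E) (x : E) : ℝ :=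
  sInf {r : ℝ | ∃ y ∈ P, ∃ z ∈ P, x = y - z ∧ r = ‖y‖ + ‖z‖}

/-- `c₊(E) = sup{‖x‖₊ : ‖x‖ ≤ 1}`. -/
def cPlus {E : Type*} [NormedAddCommGroup E] (P : Set E) : ℝ :=
  sSup {r : ℝ | ∃ x : E, ‖x‖ ≤ 1 ∧ r = normPlus P x}

/-- `P` is a closed generating cone in `E`, i.e. `E` with `P` is an ordered normed space
with `E = P − P`. -/
def IsGenCone {E : Type*} [NormedAddCommGroup E] [NormedSpace ℝ E] (P : Set E) : Prop :=
  IsClosed P ∧ (∀ x ∈ P, ∀ y ∈ P, x + y ∈ P) ∧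
    (∀ (c : ℝ), 0 ≤ c → ∀ x ∈ P, c • x ∈ P) ∧
    ∀ x : E, ∃ y ∈ P, ∃ z ∈ P, x = y - z

/-- `c₊(E)` is finite. -/
def CPlusFinite {E : Type*} [NormedAddCommGroup E] (P : Set E) : Prop :=
  BddAbove {r : ℝ | ∃ x : E, ‖x‖ ≤ 1 ∧ r = normPlus P x}

/-- The `j`-th standard basis vector of `ℓ₁^m`. -/
def l1e (m : ℕ) (j : Fin m) : PiLp 1 fun _ : Fin m => ℝ :=
  (WithLp.equiv 1 (Fin m → ℝ)).symm (Pi.single j 1)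

/-- The positive cone of coordinatewise nonnegative vectors in `ℓ₁^m`. -/
def l1cone (m : ℕ) : Set (PiLp 1 fun _ : Fin m => ℝ) := {x | ∀ i, 0 ≤ x i}

/-- `κ(n) := ‖e₁ ∨ ⋯ ∨ eₙ‖_{πs+}` computed in `ℓ₁ⁿ`, where
`x₁ ∨ ⋯ ∨ xₙ = (1/n!)·Σ_{σ ∈ Sₙ} x_{σ(1)} ⊗ ⋯ ⊗ x_{σ(n)}`. -/
def kappa (n : ℕ) : ℝ :=
  symProjNormPos (l1cone n) n
    ((n.factorial : ℝ)⁻¹ • ∑ σ : Equiv.Perm (Fin n), ⨂ₜ[ℝ] i, l1e n (σ i))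

/-- `χ_{n,N} = ((N−n)!/N!)·Σ e_{i₁} ⊗ ⋯ ⊗ e_{iₙ}`, summed over all `n`-tuples of distinct
indices in `{1,…,N}`: the distribution of a sample of size `n` drawn from `{1,…,N}`
without replacement, as a symmetric tensor in `(ℓ₁^N)^⊗n`. -/
def chiTensor (n N : ℕ) : ⨂[ℝ] (_ : Fin n), PiLp 1 fun _ : Fin N => ℝ :=
  (((N - n).factorial : ℝ) / (N.factorial : ℝ)) •
    ∑ f : Fin n ↪ Fin N, ⨂ₜ[ℝ] j, l1e N (f j)

/-- `κ(n,N) := ‖χ_{n,N}‖_{πs+}` computed in `ℓ₁^N`. -/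
def kappaNN (n N : ℕ) : ℝ :=
  symProjNormPos (l1cone N) n (chiTensor n N)

theorem aux_polar {E W : Type*} [AddCommGroup E] [Module ℝ E] [AddCommGroup W] [Module ℝ W]
    (n : ℕ) (F : MultilinearMap ℝ (fun _ : Fin n => E) W) (v : Fin n → E) :
    ∑ σ : Equiv.Perm (Fin n), F (fun i => v (σ i)) =
      ∑ T : Finset (Fin n), ((-1 : ℤ) ^ T.card) • F (fun _ => ∑ i ∈ Tᶜ, v i) := by
  classical
  have h1 : ∀ T : Finset (Fin n), F (fun _ => ∑ i ∈ Tᶜ, v i) =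
      ∑ r : Fin n → Fin n, if T ⊆ (Finset.univ.image r)ᶜ then F (fun i => v (r i)) else 0 := by
    intro T
    rw [MultilinearMap.map_sum_finset F (fun _ j => v j) (fun _ => Tᶜ), ← Finset.sum_filter]
    refine Finset.sum_congr ?_ fun _ _ => rfl
    ext r
    simp only [Fintype.mem_piFinset, Finset.mem_filter, Finset.mem_univ, true_and,
      Finset.mem_compl, Finset.subset_iff, Finset.mem_image, not_exists]
    constructor
    · intro h x hx i hi
      exact h i (hi ▸ hx)
    · intro h i hi
      exact h hi i rfl
  simp_rw [h1, Finset.smul_sum]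
  rw [Finset.sum_comm]
  have h2 : ∀ r : Fin n → Fin n, (∑ T : Finset (Fin n), ((-1 : ℤ) ^ T.card) •
      (if T ⊆ (Finset.univ.image r)ᶜ then F (fun i => v (r i)) else 0)) =
      if Function.Bijective r then F (fun i => v (r i)) else 0 := by
    intro r
    have : ∀ T : Finset (Fin n), ((-1 : ℤ) ^ T.card) •
      (if T ⊆ (Finset.univ.image r)ᶜ then F (fun i => v (r i)) else 0) =
      if T ⊆ (Finset.univ.image r)ᶜ then ((-1 : ℤ) ^ T.card) • F (fun i => v (r i)) else 0 := by
      intro T; split_ifs <;> simp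
    simp_rw [this]
    rw [← Finset.sum_filter, ← Finset.sum_smul]
    have h3 : (Finset.univ.filter fun T : Finset (Fin n) => T ⊆ (Finset.univ.image r)ᶜ) =
        (Finset.univ.image r)ᶜ.powerset := by ext; simp
    rw [h3, Finset.sum_powerset_neg_one_pow_card]
    have h4 : (Finset.univ.image r)ᶜ = ∅ ↔ Function.Bijective r := by
      rw [← Finite.surjective_iff_bijective, Finset.compl_eq_empty_iff,
        Finset.eq_univ_iff_forall]
      simp [Function.Surjective]
    simp only [h4]
    split_ifs <;> simp
  simp_rw [h2]
  rw [← Finset.sum_filter]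
  refine Finset.sum_bij (fun σ _ => (σ : Fin n → Fin n)) ?_ ?_ ?_ ?_
  · intro σ _; exact Finset.mem_filter.2 ⟨Finset.mem_univ _, σ.bijective⟩
  · intro a _ b _ h; exact DFunLike.coe_injective h
  · intro r hr
    exact ⟨Equiv.ofBijective r (Finset.mem_filter.1 hr).2, Finset.mem_univ _, rfl⟩
  · intro _ _; rfl

theorem aux_nonempty (n N : ℕ) :
    ∃ (K : ℕ) (a : Fin K → ℝ) (x : Fin K → PiLp 1 fun _ : Fin N => ℝ),
    (∀ k, x k ∈ l1cone N) ∧ chiTensor n N = ∑ k, a k • (⨂ₜ[ℝ] (_ : Fin n), x k) := by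
  classical
  set A : Set (⨂[ℝ] (_ : Fin n), PiLp 1 fun _ : Fin N => ℝ) :=
    {t | ∃ x ∈ l1cone N, t = ⨂ₜ[ℝ] (_ : Fin n), x} with hA
  have key : chiTensor n N ∈ Submodule.span ℝ A := by
    unfold chiTensor
    refine Submodule.smul_mem _ _ ?_
    have hsum : (n.factorial : ℝ) • (∑ f : Fin n ↪ Fin N, ⨂ₜ[ℝ] j, l1e N (f j)) =
        ∑ f : Fin n ↪ Fin N, ∑ σ : Equiv.Perm (Fin n), ⨂ₜ[ℝ] j, l1e N (f (σ j)) := by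
      rw [Finset.sum_comm]
      have : ∀ σ : Equiv.Perm (Fin n), (∑ f : Fin n ↪ Fin N, ⨂ₜ[ℝ] j, l1e N (f (σ j))) =
          ∑ f : Fin n ↪ Fin N, ⨂ₜ[ℝ] j, l1e N (f j) := by
        intro σ
        refine Fintype.sum_equiv (Equiv.embeddingCongr σ.symm (Equiv.refl _)) _ _ ?_
        intro f
        simp
      simp_rw [this]
      simp [Fintype.card_perm, ← Nat.cast_smul_eq_nsmul ℝ]
    have hmem : (n.factorial : ℝ) • (∑ f : Fin n ↪ Fin N, ⨂ₜ[ℝ] j, l1e N (f j)) ∈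
        Submodule.span ℝ A := by
      rw [hsum]
      refine Submodule.sum_mem _ fun f _ => ?_
      have := aux_polar n (PiTensorProduct.tprod ℝ (s := fun _ : Fin n => PiLp 1 fun _ : Fin N => ℝ))
        (fun j => l1e N (f j))
      rw [this]
      refine Submodule.sum_mem _ fun T _ => zsmul_mem (Submodule.subset_span ?_) _
      refine ⟨_, ?_, rfl⟩
      intro i
      rw [WithLp.ofLp_sum, Finset.sum_apply]
      refine Finset.sum_nonneg fun j _ => ?_
      simp only [l1e, WithLp.equiv_symm_apply]
      rw [Pi.single_apply]
      split_ifs <;> norm_num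
    have := Submodule.smul_mem _ ((n.factorial : ℝ)⁻¹) hmem
    rwa [smul_smul, inv_mul_cancel₀ (by positivity), one_smul] at this
  obtain ⟨K, a, g, h⟩ := Submodule.mem_span_set'.1 key
  choose x hx hx' using fun k => (g k).2
  exact ⟨K, a, x, hx, by simp_rw [← h, ← hx']⟩

/-- the linear functional attached to a colouring `c` -/
def auxPhi (n N : ℕ) (c : Fin N → Fin n) :
    (⨂[ℝ] (_ : Fin n), PiLp 1 fun _ : Fin N => ℝ) →ₗ[ℝ] ℝ :=
  PiTensorProduct.lift ((MultilinearMap.mkPiAlgebra ℝ (Fin n) ℝ).compLinearMap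
    (fun j => ∑ i : Fin N, if c i = j then
      ((LinearMap.proj i : (Fin N → ℝ) →ₗ[ℝ] ℝ) ∘ₗ
        (WithLp.linearEquiv 1 ℝ (Fin N → ℝ)).toLinearMap) else 0))

theorem auxPhi_tprod (n N : ℕ) (c : Fin N → Fin n) (x : Fin n → PiLp 1 fun _ : Fin N => ℝ) :
    auxPhi n N c (⨂ₜ[ℝ] j, x j) = ∏ j, ∑ i, if c i = j then x j i else 0 := by
  simp only [auxPhi, PiTensorProduct.lift.tprod, MultilinearMap.compLinearMap_apply,
    MultilinearMap.mkPiAlgebra_apply, LinearMap.sum_apply]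
  refine Finset.prod_congr rfl fun j _ => Finset.sum_congr rfl fun i _ => ?_
  split_ifs <;> simp

theorem aux_amgm (n : ℕ) (hn : 1 ≤ n) (y : Fin n → ℝ) (hy : ∀ j, 0 ≤ y j) :
    (n : ℝ) ^ n * ∏ j, y j ≤ (∑ j, y j) ^ n := by
  have hn0 : (0 : ℝ) < n := by exact_mod_cast hn
  have := Real.geom_mean_le_arith_mean Finset.univ (fun _ => (1 : ℝ)) y (by simp)
    (by simpa using hn0) (fun j _ => hy j)
  simp only [Real.rpow_one, Finset.sum_const, Finset.card_univ, Fintype.card_fin, nsmul_eq_mul,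
    mul_one, one_mul] at this
  have hp : 0 ≤ ∏ j, y j := Finset.prod_nonneg fun j _ => hy j
  have h2 := pow_le_pow_left₀ (Real.rpow_nonneg hp _) this n
  rw [Real.rpow_inv_natCast_pow hp (by omega), div_pow, le_div_iff₀ (by positivity)] at h2
  linarith

theorem auxPhi_bound (n N : ℕ) (hn : 1 ≤ n) (c : Fin N → Fin n) (x : PiLp 1 fun _ : Fin N => ℝ)
    (hx : x ∈ l1cone N) :
    |(n : ℝ) ^ n * auxPhi n N c (⨂ₜ[ℝ] (_ : Fin n), x)| ≤ ‖x‖ ^ n := by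
  rw [auxPhi_tprod]
  have hnn : ∀ j : Fin n, 0 ≤ ∑ i, if c i = j then x i else 0 := fun j =>
    Finset.sum_nonneg fun i _ => by split_ifs; exacts [hx i, le_rfl]
  rw [abs_of_nonneg (mul_nonneg (by positivity) (Finset.prod_nonneg fun j _ => hnn j))]
  refine (aux_amgm n hn _ hnn).trans (le_of_eq ?_)
  congr 1
  rw [Finset.sum_comm, PiLp.norm_eq_of_L1]
  refine Finset.sum_congr rfl fun i _ => ?_
  simp [abs_of_nonneg (hx i)]

theorem auxPhi_basis (n N : ℕ) (c : Fin N → Fin n) (f : Fin n → Fin N) :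
    auxPhi n N c (⨂ₜ[ℝ] j, l1e N (f j)) = if ∀ j, c (f j) = j then 1 else 0 := by
  rw [auxPhi_tprod]
  have : ∀ j, (∑ i, if c i = j then (l1e N (f j)) i else 0) = if c (f j) = j then (1 : ℝ) else 0 := by
    intro j
    rw [Finset.sum_eq_single (f j)]
    · simp [l1e]
    · intro b _ hb
      simp [l1e, hb]
    · simp
  simp_rw [this]
  rw [Finset.prod_ite_zero]
  simp

theorem aux_count (n m : ℕ) (h : Fin n ↪ Fin n × Fin m) :
    ((n * m).descFactorial n : ℝ) *
      ∑ σ : Equiv.Perm (Fin n × Fin m), (if ∀ j, (σ (h j)).1 = j then (1 : ℝ) else 0) =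
    (Fintype.card (Equiv.Perm (Fin n × Fin m)) : ℝ) * (m : ℝ) ^ n := by
  classical
  have hconst : ∀ h' : Fin n ↪ Fin n × Fin m,
      ∑ σ : Equiv.Perm (Fin n × Fin m), (if ∀ j, (σ (h' j)).1 = j then (1 : ℝ) else 0) =
      ∑ σ : Equiv.Perm (Fin n × Fin m), (if ∀ j, (σ (h j)).1 = j then (1 : ℝ) else 0) := by
    intro h'
    have hp : MulAction.IsMultiplyPretransitive (Equiv.Perm (Fin n × Fin m)) (Fin n × Fin m) n :=
      Equiv.Perm.isMultiplyPretransitive _ _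
    obtain ⟨τ, hτ⟩ := hp.exists_smul_eq h h'
    refine Fintype.sum_equiv (Equiv.mulRight τ) _ _ ?_
    intro σ
    subst hτ
    exact if_congr (by simp [Equiv.Perm.smul_def]) rfl rfl
  have hcard : ((n * m).descFactorial n : ℝ) = (Fintype.card (Fin n ↪ Fin n × Fin m) : ℝ) := by
    rw [Fintype.card_embedding_eq]; simp
  have hin : ∀ σ : Equiv.Perm (Fin n × Fin m),
      (∑ h' : Fin n ↪ Fin n × Fin m, (if ∀ j, (σ (h' j)).1 = j then (1 : ℝ) else 0)) =
      (m : ℝ) ^ n := by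
    intro σ
    have e1 : (∑ h' : Fin n ↪ Fin n × Fin m, (if ∀ j, (σ (h' j)).1 = j then (1 : ℝ) else 0)) =
      ∑ h' : Fin n ↪ Fin n × Fin m, (if ∀ j, (h' j).1 = j then (1 : ℝ) else 0) := by
      refine Fintype.sum_equiv (Equiv.embeddingCongr (Equiv.refl _) σ) _ _ ?_
      intro f
      simp
    rw [e1, Finset.sum_boole]
    have : (Finset.univ.filter fun h' : Fin n ↪ Fin n × Fin m => ∀ j, (h' j).1 = j).card =
        (Finset.univ : Finset (Fin n → Fin m)).card := by
      refine Finset.card_bij' (fun h' _ j => (h' j).2)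
        (fun g _ => ⟨fun j => (j, g j), fun a b hab => (Prod.mk.inj hab).1⟩) ?_ ?_ ?_ ?_
      · simp
      · intro a _
        exact Finset.mem_filter.2 ⟨Finset.mem_univ _, fun j => rfl⟩
      · intro a ha
        simp only [Finset.mem_filter, Finset.mem_univ, true_and] at ha
        ext j : 1
        exact Prod.ext (ha j).symm rfl
      · intro a ha
        rfl
    rw [this]
    simp
  calc _ = ∑ h' : Fin n ↪ Fin n × Fin m, ∑ σ : Equiv.Perm (Fin n × Fin m),
        (if ∀ j, (σ (h' j)).1 = j then (1 : ℝ) else 0) := by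
        simp_rw [hconst]
        rw [hcard, Finset.sum_const, Finset.card_univ, nsmul_eq_mul]
    _ = _ := by
        rw [Finset.sum_comm]
        simp_rw [hin]
        rw [Finset.sum_const, Finset.card_univ, nsmul_eq_mul]

theorem aux_exp (n M : ℕ) (hn : n ≤ M) (hM : 0 < M) :
    Real.exp ((n : ℝ) * ((n : ℝ) - 1) / (2 * M)) * (M.descFactorial n : ℝ) ≤ (M : ℝ) ^ n := by
  have hM' : (0 : ℝ) < M := by exact_mod_cast hM
  induction n with
  | zero => simp
  | succ k ih =>
    have ih := ih (by omega)
    rw [Nat.descFactorial_succ, pow_succ]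
    have e : ((k + 1 : ℕ) : ℝ) * (((k + 1 : ℕ) : ℝ) - 1) / (2 * M) =
        (k : ℝ) * ((k : ℝ) - 1) / (2 * M) + k / M := by
      push_cast; field_simp; ring
    rw [e, Real.exp_add]
    push_cast [Nat.cast_sub (show k ≤ M by omega)]
    have h1 : Real.exp ((k : ℝ) / M) * ((M : ℝ) - k) ≤ M := by
      have h2 := Real.add_one_le_exp (-((k : ℝ) / M))
      have h3 : ((M : ℝ) - k) ≤ M * Real.exp (-((k : ℝ) / M)) := by
        calc ((M : ℝ) - k) = M * (-((k : ℝ) / M) + 1) := by field_simp; ring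
          _ ≤ _ := mul_le_mul_of_nonneg_left h2 hM'.le
      calc _ ≤ Real.exp ((k : ℝ) / M) * (M * Real.exp (-((k : ℝ) / M))) :=
            mul_le_mul_of_nonneg_left h3 (Real.exp_pos _).le
        _ = M * (Real.exp ((k : ℝ) / M) * Real.exp (-((k : ℝ) / M))) := by ring
        _ = M := by rw [← Real.exp_add]; simp
    have hk : (0 : ℝ) ≤ (M : ℝ) - k := by
      have : (k : ℝ) ≤ M := by exact_mod_cast (show k ≤ M by omega)
      linarith
    calc _ = (Real.exp ((k : ℝ) * ((k : ℝ) - 1) / (2 * M)) * (M.descFactorial k : ℝ)) *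
          (Real.exp ((k : ℝ) / M) * ((M : ℝ) - k)) := by ring
      _ ≤ _ := mul_le_mul ih h1 (mul_nonneg (Real.exp_pos _).le hk) (by positivity)

theorem aux_lower (n N m : ℕ) (hn : 1 ≤ n) (hnN : n ≤ N) (hm : N ≤ n * m) (s : ℝ)
    (hs : ∀ c : Fin N → Fin n, (n : ℝ) ^ n * auxPhi n N c (chiTensor n N) ≤ s) :
    Real.exp (((n : ℝ) - 1) / (2 * m)) ≤ s := by
  classical
  have hm0 : 0 < m := by
    rcases Nat.eq_zero_or_pos m with h | h
    · subst h; omega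
    · exact h
  have hcard : Fintype.card (Fin N) ≤ Fintype.card (Fin n × Fin m) := by simpa using hm
  obtain ⟨ι⟩ := Function.Embedding.nonempty_of_card_le hcard
  set P : ℝ := (Fintype.card (Equiv.Perm (Fin n × Fin m)) : ℝ) with hP
  have hP0 : 0 < P := by
    rw [hP]; exact_mod_cast Fintype.card_pos
  set D : ℝ := ((n * m).descFactorial n : ℝ) with hD
  have hD0 : 0 < D := by
    rw [hD]; exact_mod_cast Nat.descFactorial_pos.2 (by omega)
  have hsum : ∑ σ : Equiv.Perm (Fin n × Fin m),
      (n : ℝ) ^ n * auxPhi n N (fun i => (σ (ι i)).1) (chiTensor n N) ≤ P * s := by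
    refine (Finset.sum_le_sum fun σ _ => hs _).trans (le_of_eq ?_)
    rw [Finset.sum_const, Finset.card_univ, nsmul_eq_mul]
  have hval : ∑ σ : Equiv.Perm (Fin n × Fin m),
      (n : ℝ) ^ n * auxPhi n N (fun i => (σ (ι i)).1) (chiTensor n N) =
      (n : ℝ) ^ n * (P * (m : ℝ) ^ n / D) := by
    rw [← Finset.mul_sum]
    congr 1
    simp only [chiTensor, map_smul, map_sum, auxPhi_basis, smul_eq_mul]
    rw [← Finset.mul_sum, Finset.sum_comm]
    have : ∀ f : Fin n ↪ Fin N, (∑ σ : Equiv.Perm (Fin n × Fin m),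
        if ∀ j, (σ (ι (f j))).1 = j then (1 : ℝ) else 0) = P * (m : ℝ) ^ n / D := by
      intro f
      rw [eq_div_iff hD0.ne', mul_comm]
      exact aux_count n m (f.trans ι)
    simp_rw [this]
    rw [Finset.sum_const, Finset.card_univ, nsmul_eq_mul, Fintype.card_embedding_eq,
      Fintype.card_fin, Fintype.card_fin, ← mul_assoc]
    have h1 : ((N - n).factorial : ℝ) * (N.descFactorial n : ℝ) = N.factorial := by
      exact_mod_cast Nat.factorial_mul_descFactorial hnN
    rw [div_mul_eq_mul_div, h1, div_self (by positivity), one_mul]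
  rw [hval] at hsum
  have h1 : ((n : ℝ) * m) ^ n / D ≤ s := by
    have : P * (((n : ℝ) * m) ^ n / D) ≤ P * s := by
      refine le_trans (le_of_eq ?_) hsum
      rw [mul_pow]; ring
    exact le_of_mul_le_mul_left this hP0
  refine le_trans ?_ h1
  rw [le_div_iff₀ hD0]
  have := aux_exp n (n * m) (by omega) (by positivity)
  have hn0 : (n : ℝ) ≠ 0 := by positivity
  have hm0' : (m : ℝ) ≠ 0 := by positivity
  have e : (n : ℝ) * ((n : ℝ) - 1) / (2 * ((n * m : ℕ) : ℝ)) = ((n : ℝ) - 1) / (2 * m) := by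
    push_cast; field_simp
  rw [e] at this
  push_cast at this
  exact this

/-- If `1 ≤ n ≤ N`, then `κ(n,N) ≥ exp((n−1)/(2⌈N/n⌉)) ≥ 1 + n(n−1)/(2(N+n))`. -/
theorem kappaNN_lower (n N : ℕ) (hn : 1 ≤ n) (hnN : n ≤ N) :
    Real.exp (((n : ℝ) - 1) / (2 * (⌈(N : ℝ) / (n : ℝ)⌉₊ : ℝ))) ≤ kappaNN n N ∧
      1 + (n : ℝ) * ((n : ℝ) - 1) / (2 * ((N : ℝ) + (n : ℝ))) ≤
        Real.exp (((n : ℝ) - 1) / (2 * (⌈(N : ℝ) / (n : ℝ)⌉₊ : ℝ))) := by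
  have hn0 : (0 : ℝ) < n := by exact_mod_cast hn
  have hN0 : (0 : ℝ) < N := by exact_mod_cast (show 0 < N by omega)
  set m := ⌈(N : ℝ) / (n : ℝ)⌉₊ with hm
  have hm1 : (N : ℝ) / n ≤ m := Nat.le_ceil _
  have hm2 : (m : ℝ) < (N : ℝ) / n + 1 := Nat.ceil_lt_add_one (by positivity)
  have hmpos : (0 : ℝ) < m := lt_of_lt_of_le (by positivity) hm1
  have hNm : N ≤ n * m := by
    rw [div_le_iff₀ hn0] at hm1
    have : (N : ℝ) ≤ ((n * m : ℕ) : ℝ) := by push_cast; linarith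
    exact_mod_cast this
  constructor
  · unfold kappaNN symProjNormPos
    refine le_csInf ?_ ?_
    · obtain ⟨K, a, x, hx, h⟩ := aux_nonempty n N
      exact ⟨_, K, a, x, hx, h, rfl⟩
    · rintro s ⟨K, a, x, hx, h, rfl⟩
      refine aux_lower n N m hn hnN hNm _ fun c => ?_
      rw [h, map_sum, Finset.mul_sum]
      refine Finset.sum_le_sum fun k _ => ?_
      rw [map_smul, smul_eq_mul]
      calc (n : ℝ) ^ n * (a k * auxPhi n N c (⨂ₜ[ℝ] (_ : Fin n), x k))
          = a k * ((n : ℝ) ^ n * auxPhi n N c (⨂ₜ[ℝ] (_ : Fin n), x k)) := by ring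
        _ ≤ |a k * ((n : ℝ) ^ n * auxPhi n N c (⨂ₜ[ℝ] (_ : Fin n), x k))| := le_abs_self _
        _ = |a k| * |(n : ℝ) ^ n * auxPhi n N c (⨂ₜ[ℝ] (_ : Fin n), x k)| := abs_mul _ _
        _ ≤ _ := mul_le_mul_of_nonneg_left (auxPhi_bound n N hn c (x k) (hx k)) (abs_nonneg _)
  · have h1 := Real.add_one_le_exp (((n : ℝ) - 1) / (2 * (m : ℝ)))
    have h2 : (n : ℝ) * ((n : ℝ) - 1) / (2 * ((N : ℝ) + (n : ℝ))) ≤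
        ((n : ℝ) - 1) / (2 * (m : ℝ)) := by
      have hn1 : (0 : ℝ) ≤ (n : ℝ) - 1 := by
        have : (1 : ℝ) ≤ n := by exact_mod_cast hn
        linarith
      have h3 : (n : ℝ) * m ≤ N + n := by
        have := mul_le_mul_of_nonneg_left hm2.le hn0.le
        have e : (n : ℝ) * ((N : ℝ) / n + 1) = N + n := by field_simp
        linarith
      rw [div_le_div_iff₀ (by positivity) (by positivity)]
      nlinarith [mul_le_mul_of_nonneg_left h3 hn1]
    linarith


end
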